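/- arXiv:2601.12750 — 4 statements merged into one kernel-verified Lean document; each statement's English description precedes it below -/
import Mathlib

section
/- For every sequential hiring instance there exists a hiring policy H* that is simultaneously optimal and canonical: R(H*) ≥ R(H) for every hiring policy H, and for every state (t, κ, A) with 1 ≤ t ≤ T, 1 ≤ κ ≤ k, A ≠ ∅, writing i = H*(t, κ, A), one has R_{H*}(t+1, κ−1, A ∖ {i}) ≤ R_{H*}(t+1, κ, A ∖ {i}) ≤ v_i + R_{H*}(t+1, κ−1, A ∖ {i}). -/
/-- A hiring policy: assigns to every state `(t, κ, A)` an applicant. -/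
def Policy (n : ℕ) : Type := ℕ → ℕ → Finset (Fin n) → Fin n

/-- A hiring policy is valid if at every state `(t, κ, A)` with `1 ≤ t ≤ T`,
`1 ≤ κ ≤ k`, and `A ≠ ∅`, it selects an available applicant. -/
def ValidPolicy (n k T : ℕ) (H : Policy n) : Prop :=
  ∀ t κ : ℕ, ∀ A : Finset (Fin n), 1 ≤ t → t ≤ T → 1 ≤ κ → κ ≤ k → A.Nonempty →
    H t κ A ∈ A

/-- Expected reward, with explicit fuel `T + 1 - t`. -/
noncomputable def rewardAux {n : ℕ} (v p : Fin n → ℝ) (H : Policy n) :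
    ℕ → ℕ → ℕ → Finset (Fin n) → ℝ
  | 0, _, _, _ => 0
  | fuel + 1, t, κ, A =>
    if κ = 0 ∨ A = ∅ then 0
    else
      p (H t κ A) * (v (H t κ A) +
          rewardAux v p H fuel (t + 1) (κ - 1) (A.erase (H t κ A))) +
        (1 - p (H t κ A)) * rewardAux v p H fuel (t + 1) κ (A.erase (H t κ A))

/-- Expected reward `R_H(t, κ, A)` of policy `H` from state `(t, κ, A)`;
it vanishes as soon as `t = T + 1`, `κ = 0`, or `A = ∅`. -/
noncomputable def reward {n : ℕ} (v p : Fin n → ℝ) (T : ℕ) (H : Policy n)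
    (t κ : ℕ) (A : Finset (Fin n)) : ℝ :=
  rewardAux v p H (T + 1 - t) t κ A

/-- Total expected reward `R(H) = R_H(1, k, [n])`. -/
noncomputable def totalReward {n : ℕ} (v p : Fin n → ℝ) (k T : ℕ) (H : Policy n) : ℝ :=
  reward v p T H 1 k Finset.univ

/-- A policy is canonical: the L≥R and V+R≥L properties hold at every state. -/
def Canonical {n : ℕ} (v p : Fin n → ℝ) (k T : ℕ) (H : Policy n) : Prop :=
  ∀ t κ : ℕ, ∀ A : Finset (Fin n), 1 ≤ t → t ≤ T → 1 ≤ κ → κ ≤ k → A.Nonempty →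
    reward v p T H (t + 1) (κ - 1) (A.erase (H t κ A)) ≤
        reward v p T H (t + 1) κ (A.erase (H t κ A)) ∧
      reward v p T H (t + 1) κ (A.erase (H t κ A)) ≤
        v (H t κ A) + reward v p T H (t + 1) (κ - 1) (A.erase (H t κ A))

/-- Expected reward of offering to applicant `i` in state `(κ, A)` when the continuation reward
is given by `f`. -/
noncomputable def offerValue {n : ℕ} (v p : Fin n → ℝ) (f : ℕ → Finset (Fin n) → ℝ) (κ : ℕ)
    (A : Finset (Fin n)) (i : Fin n) : ℝ :=
  p i * (v i + f (κ - 1) (A.erase i)) + (1 - p i) * f κ (A.erase i)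

/-- Optimal expected reward with a given number of remaining steps, by dynamic programming. -/
noncomputable def optValue {n : ℕ} (v p : Fin n → ℝ) : ℕ → ℕ → Finset (Fin n) → ℝ
  | 0, _, _ => 0
  | m + 1, κ, A =>
    if h : κ ≠ 0 ∧ A.Nonempty then A.sup' h.2 (offerValue v p (optValue v p m) κ A) else 0

section

variable {n : ℕ} {v p : Fin n → ℝ}

theorem rewardAux_succ {H : Policy n} {m t κ : ℕ} {A : Finset (Fin n)} (hκ : κ ≠ 0)
    (hA : A.Nonempty) :
    rewardAux v p H (m + 1) t κ A =
      offerValue v p (rewardAux v p H m (t + 1)) κ A (H t κ A) := by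
  simp [rewardAux, offerValue, hκ, hA.ne_empty]

theorem offerValue_le_offerValue (hp : ∀ i, 0 ≤ p i ∧ p i ≤ 1)
    {f g : ℕ → Finset (Fin n) → ℝ} {κ κ' : ℕ} {A B : Finset (Fin n)} {i : Fin n}
    (h₁ : f (κ - 1) (A.erase i) ≤ g (κ' - 1) (B.erase i))
    (h₂ : f κ (A.erase i) ≤ g κ' (B.erase i)) :
    offerValue v p f κ A i ≤ offerValue v p g κ' B i := by
  have h₃ := (hp i).1
  have h₄ : 0 ≤ 1 - p i := sub_nonneg.2 (hp i).2
  unfold offerValue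
  gcongr

theorem optValue_succ_eq_zero {m κ : ℕ} {A : Finset (Fin n)} (h : κ = 0 ∨ A = ∅) :
    optValue v p (m + 1) κ A = 0 := by
  rw [optValue, dif_neg]
  rintro ⟨h₁, h₂⟩
  exact h.elim h₁ h₂.ne_empty

theorem offerValue_le_optValue {m κ : ℕ} {A : Finset (Fin n)} {i : Fin n} (hκ : κ ≠ 0)
    (hi : i ∈ A) : offerValue v p (optValue v p m) κ A i ≤ optValue v p (m + 1) κ A := by
  rw [optValue, dif_pos ⟨hκ, i, hi⟩]
  exact Finset.le_sup' _ hi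

theorem exists_optValue_eq_offerValue (m : ℕ) {κ : ℕ} {A : Finset (Fin n)} (hκ : κ ≠ 0)
    (hA : A.Nonempty) :
    ∃ i ∈ A, optValue v p (m + 1) κ A = offerValue v p (optValue v p m) κ A i := by
  rw [optValue, dif_pos ⟨hκ, hA⟩]
  exact Finset.exists_mem_eq_sup' hA _

theorem optValue_nonneg (hv : ∀ i, 0 ≤ v i) (hp : ∀ i, 0 ≤ p i ∧ p i ≤ 1) (m κ : ℕ)
    (A : Finset (Fin n)) : 0 ≤ optValue v p m κ A := by
  induction m generalizing κ A with
  | zero => exact le_rfl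
  | succ m ih =>
    by_cases h : κ = 0 ∨ A = ∅
    · exact (optValue_succ_eq_zero h).ge
    · push Not at h
      obtain ⟨i, hi⟩ := h.2
      exact le_trans (add_nonneg (mul_nonneg (hp i).1 (add_nonneg (hv i) (ih _ _)))
        (mul_nonneg (sub_nonneg.2 (hp i).2) (ih _ _))) (offerValue_le_optValue h.1 hi)

/-- The optimal value is monotone in the remaining time, the open positions and the pool. -/
theorem optValue_mono (hv : ∀ i, 0 ≤ v i) (hp : ∀ i, 0 ≤ p i ∧ p i ≤ 1) {m m' κ κ' : ℕ}
    {A B : Finset (Fin n)} (hm : m ≤ m') (hκ : κ ≤ κ') (hAB : A ⊆ B) :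
    optValue v p m κ A ≤ optValue v p m' κ' B := by
  induction m generalizing m' κ κ' A B with
  | zero => exact optValue_nonneg hv hp _ _ _
  | succ m ih =>
    by_cases h : κ = 0 ∨ A = ∅
    · exact (optValue_succ_eq_zero h).trans_le (optValue_nonneg hv hp _ _ _)
    · push Not at h
      obtain ⟨m', rfl⟩ : ∃ r, m' = r + 1 := ⟨m' - 1, by omega⟩
      obtain ⟨i, hi, hopt⟩ := exists_optValue_eq_offerValue (v := v) (p := p) m h.1 h.2
      have he := Finset.erase_subset_erase i hAB
      exact hopt.trans_le ((offerValue_le_offerValue hp (ih (by omega) (by omega) he)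
        (ih (by omega) hκ he)).trans (offerValue_le_optValue (by omega) (hAB hi)))

theorem exists_optimal_offer_acceptance_pos (hv : ∀ i, 0 ≤ v i) (hp : ∀ i, 0 ≤ p i ∧ p i ≤ 1)
    {m κ : ℕ} {A : Finset (Fin n)} (hpos : 0 < optValue v p (m + 1) κ A) :
    ∃ i ∈ A, optValue v p (m + 1) κ A = offerValue v p (optValue v p m) κ A i ∧ 0 < p i := by
  induction m generalizing A with
  | zero =>
    have h : ¬(κ = 0 ∨ A = ∅) := fun h => hpos.ne' (optValue_succ_eq_zero h)
    push Not at h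
    obtain ⟨i, hi, hopt⟩ := exists_optValue_eq_offerValue (v := v) (p := p) 0 h.1 h.2
    refine ⟨i, hi, hopt, (hp i).1.lt_of_ne fun h₀ => hpos.ne' ?_⟩
    rw [hopt, offerValue, ← h₀]
    simp [optValue]
  | succ m ih =>
    have h : ¬(κ = 0 ∨ A = ∅) := fun h => hpos.ne' (optValue_succ_eq_zero h)
    push Not at h
    obtain ⟨i, hi, hopt⟩ := exists_optValue_eq_offerValue (v := v) (p := p) (m + 1) h.1 h.2
    rcases (hp i).1.eq_or_lt with h₀ | h₀
    · have heq : optValue v p (m + 2) κ A = optValue v p (m + 1) κ (A.erase i) := by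
        simp [hopt, offerValue, ← h₀]
      obtain ⟨j, hj, hjopt, hjpos⟩ := ih (heq ▸ hpos)
      have hjA := Finset.mem_of_mem_erase hj
      have he := Finset.erase_subset_erase j (Finset.erase_subset i A)
      refine ⟨j, hjA, le_antisymm ?_ (offerValue_le_optValue h.1 hjA), hjpos⟩
      rw [heq, hjopt]
      exact offerValue_le_offerValue hp (optValue_mono hv hp (by omega) le_rfl he)
        (optValue_mono hv hp (by omega) le_rfl he)
    · exact ⟨i, hi, hopt, h₀⟩

theorem exists_optimal_canonical_offer (hv : ∀ i, 0 ≤ v i) (hp : ∀ i, 0 ≤ p i ∧ p i ≤ 1)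
    (m : ℕ) {κ : ℕ} {A : Finset (Fin n)} (hκ : κ ≠ 0) (hA : A.Nonempty) :
    ∃ i ∈ A, optValue v p (m + 1) κ A = offerValue v p (optValue v p m) κ A i ∧
      optValue v p m κ (A.erase i) ≤ v i + optValue v p m (κ - 1) (A.erase i) := by
  have hmono (i : Fin n) : optValue v p m κ (A.erase i) ≤ optValue v p (m + 1) κ A :=
    optValue_mono hv hp (Nat.le_succ m) le_rfl (Finset.erase_subset i A)
  rcases (optValue_nonneg hv hp (m + 1) κ A).eq_or_lt with h₀ | h₀
  · obtain ⟨i, hi, hopt⟩ := exists_optValue_eq_offerValue (v := v) (p := p) m hκ hA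
    exact ⟨i, hi, hopt, ((hmono i).trans h₀.ge).trans
      (add_nonneg (hv i) (optValue_nonneg hv hp _ _ _))⟩
  · obtain ⟨i, hi, hopt, hpos⟩ := exists_optimal_offer_acceptance_pos hv hp h₀
    refine ⟨i, hi, hopt, le_of_mul_le_mul_left ?_ hpos⟩
    have := hmono i
    rw [hopt, offerValue] at this
    linarith

/-- No valid policy beats the dynamic program. -/
theorem rewardAux_le_optValue (hp : ∀ i, 0 ≤ p i ∧ p i ≤ 1) {k T : ℕ} {H : Policy n}
    (hH : ValidPolicy n k T H) {m t κ : ℕ} (A : Finset (Fin n)) (ht : 1 ≤ t)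
    (hmt : t + m = T + 1) (hκ : κ ≤ k) : rewardAux v p H m t κ A ≤ optValue v p m κ A := by
  induction m generalizing t κ A with
  | zero => exact le_rfl
  | succ m ih =>
    by_cases h : κ = 0 ∨ A = ∅
    · rw [optValue_succ_eq_zero h, rewardAux, if_pos h]
    · push Not at h
      rw [rewardAux_succ h.1 h.2]
      exact (offerValue_le_offerValue hp (ih _ (by omega) (by omega) (by omega))
        (ih _ (by omega) (by omega) hκ)).trans
        (offerValue_le_optValue h.1 (hH t κ A ht (by omega) (by omega) hκ h.2))

/-- A policy whose offers attain the dynamic programming optimum attains the optimal value. -/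
theorem rewardAux_eq_optValue {T : ℕ} {H : Policy n}
    (hH : ∀ t κ A, κ ≠ 0 → A.Nonempty → optValue v p (T - t + 1) κ A =
      offerValue v p (optValue v p (T - t)) κ A (H t κ A))
    {m t : ℕ} (κ : ℕ) (A : Finset (Fin n)) (hmt : t + m = T + 1) :
    rewardAux v p H m t κ A = optValue v p m κ A := by
  induction m generalizing t κ A with
  | zero => rfl
  | succ m ih =>
    by_cases h : κ = 0 ∨ A = ∅
    · rw [optValue_succ_eq_zero h, rewardAux, if_pos h]
    · push Not at h
      obtain rfl : m = T - t := by omega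
      rw [rewardAux_succ h.1 h.2, hH t κ A h.1 h.2, offerValue, offerValue,
        ih _ _ (by omega), ih _ _ (by omega)]

end

/-- For every sequential hiring instance there exists a hiring
policy `H*` that is simultaneously optimal and canonical. -/
theorem exists_optimal_canonical_policy
    (n k T : ℕ) (v p : Fin n → ℝ)
    (hn : 1 ≤ n) (hk : 1 ≤ k) (hT : 1 ≤ T)
    (hv : ∀ i, 0 ≤ v i) (hp : ∀ i, 0 ≤ p i ∧ p i ≤ 1) :
    ∃ Hstar : Policy n, ValidPolicy n k T Hstar ∧
      (∀ H : Policy n, ValidPolicy n k T H →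
        totalReward v p k T H ≤ totalReward v p k T Hstar) ∧
      Canonical v p k T Hstar := by
  have key (m κ : ℕ) (A : Finset (Fin n)) : ∃ i, κ ≠ 0 → A.Nonempty → i ∈ A ∧
      optValue v p (m + 1) κ A = offerValue v p (optValue v p m) κ A i ∧
      optValue v p m κ (A.erase i) ≤ v i + optValue v p m (κ - 1) (A.erase i) := by
    by_cases h : κ ≠ 0 ∧ A.Nonempty
    · obtain ⟨i, hi⟩ := exists_optimal_canonical_offer hv hp m h.1 h.2
      exact ⟨i, fun _ _ => hi⟩
    · exact ⟨⟨0, hn⟩, fun h₁ h₂ => absurd ⟨h₁, h₂⟩ h⟩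
  choose best hbest using key
  let H : Policy n := fun t => best (T - t)
  have hH {m t : ℕ} (κ : ℕ) (A : Finset (Fin n)) (hmt : t + m = T + 1) :
      rewardAux v p H m t κ A = optValue v p m κ A :=
    rewardAux_eq_optValue (fun t κ A hκ hA => (hbest (T - t) κ A hκ hA).2.1) κ A hmt
  refine ⟨H, fun t κ A _ _ hκ _ hA => (hbest (T - t) κ A (by omega) hA).1,
    fun H' hH' => ?_, fun t κ A _ htT hκ _ hA => ?_⟩
  · rw [totalReward, totalReward, reward, reward, hH _ _ (by omega)]
    exact rewardAux_le_optValue hp hH' _ le_rfl (by omega) le_rfl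
  · simp only [reward, show T + 1 - (t + 1) = T - t by omega]
    rw [hH _ _ (by omega), hH _ _ (by omega)]
    exact ⟨optValue_mono hv hp le_rfl (Nat.sub_le κ 1) subset_rfl,
      (hbest (T - t) κ A (by omega) hA).2.2⟩
end

section
/- Let H be a hiring policy that is canonical for the original instance I. Then its total expected reward with respect to the mixed-rounded instance satisfies R^{I↕}(H) ≥ (1 − 2ε)·R^I(H). -/
/-- `(v', p')` are the value/probability vectors of the mixed-rounded instance `I↕`
obtained from `(v, p)` with parameters `ε` and `γ = ε / T`: class-`C₀` applicants
(`p i ≤ γ`) get probability `γ` and value `p i * v i / γ`, while a class-`C_m`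
applicant (`(1+ε)^{m-1}·γ < p i ≤ (1+ε)^m·γ`, `m ≥ 1`) gets probability
`(1+ε)^{m-1}·γ` and an unchanged value. -/
def MixedRounded (n : ℕ) (v p : Fin n → ℝ) (ε γ : ℝ) (v' p' : Fin n → ℝ) : Prop :=
  ∀ i : Fin n,
    (p i ≤ γ → p' i = γ ∧ v' i = p i * v i / γ) ∧
    ∀ m : ℕ, 1 ≤ m → (1 + ε) ^ (m - 1) * γ < p i → p i ≤ (1 + ε) ^ m * γ →
      p' i = (1 + ε) ^ (m - 1) * γ ∧ v' i = v i

theorem rewardAux_nonneg {n : ℕ} {v p : Fin n → ℝ} (hv : ∀ i, 0 ≤ v i)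
    (hp : ∀ i, 0 ≤ p i ∧ p i ≤ 1) (H : Policy n) (f t κ : ℕ) (A : Finset (Fin n)) :
    0 ≤ rewardAux v p H f t κ A := by
  induction f generalizing t κ A with
  | zero => simp [rewardAux]
  | succ f ih =>
    rw [rewardAux]
    split_ifs
    · exact le_rfl
    · exact add_nonneg (mul_nonneg (hp _).1 (add_nonneg (hv _) (ih _ _ _)))
        (mul_nonneg (sub_nonneg.2 (hp _).2) (ih _ _ _))

/-- Each applicant either keeps its value, its probability being divided by at most `1 + ε`,
or has its probability raised to `γ`, with the same expected immediate reward. -/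
theorem MixedRounded.cases {n : ℕ} {v p v' p' : Fin n → ℝ} {ε γ : ℝ} (hε : 0 < ε) (hγ : 0 < γ)
    (hmix : MixedRounded n v p ε γ v' p') (i : Fin n) :
    (p' i = γ ∧ γ * v' i = p i * v i) ∨
      (v' i = v i ∧ 0 ≤ p' i ∧ p' i ≤ p i ∧ p i ≤ (1 + ε) * p' i) := by
  rcases le_or_gt (p i) γ with h | h
  · obtain ⟨h₁, h₂⟩ := (hmix i).1 h
    exact .inl ⟨h₁, by rw [h₂]; field_simp⟩
  · right
    have hex : ∃ m : ℕ, p i ≤ (1 + ε) ^ m * γ := by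
      obtain ⟨m, hm⟩ := pow_unbounded_of_one_lt (p i / γ) (show 1 < 1 + ε by linarith)
      exact ⟨m, ((div_lt_iff₀ hγ).1 hm).le⟩
    classical
    have hm := Nat.find_spec hex
    have hmin := fun j => Nat.find_min hex (m := j)
    generalize Nat.find hex = m at hm hmin
    rcases m with _ | m
    · simp only [pow_zero, one_mul] at hm
      linarith
    · have hlt : (1 + ε) ^ m * γ < p i := not_le.1 (hmin m (Nat.lt_succ_self m))
      obtain ⟨h₁, h₂⟩ := (hmix i).2 (m + 1) (by omega) (by simpa using hlt) hm
      simp only [Nat.add_sub_cancel] at h₁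
      refine ⟨h₂, ?_, ?_, ?_⟩
      · rw [h₁]; positivity
      · rw [h₁]; exact hlt.le
      · rw [h₁]; calc
          p i ≤ (1 + ε) ^ (m + 1) * γ := hm
          _ = (1 + ε) * ((1 + ε) ^ m * γ) := by ring

/-- One step when the probability is rounded down and the value is kept. -/
theorem step_le_of_prob_rounded_down {ε a p p' v L R L' R' : ℝ} (ha : 0 ≤ a)
    (haε : a * (1 + ε) ≤ 1) (hε : 0 ≤ ε) (hp' : 0 ≤ p') (hp'p : p' ≤ p) (hp : p ≤ 1)
    (hpp' : p ≤ (1 + ε) * p') (hLR : L ≤ R) (hRL : R ≤ v + L)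
    (hL : a * L ≤ L') (hR : a * R ≤ R') :
    a * (p * (v + L) + (1 - p) * R) ≤ p' * (v + L') + (1 - p') * R' := by
  have ha1 : a ≤ 1 := by nlinarith
  calc
    a * (p * (v + L) + (1 - p) * R) = a * R + a * (p * (v + L - R)) := by ring
    _ ≤ a * R + a * ((1 + ε) * p' * (v + L - R)) := by gcongr
    _ = a * R + a * (1 + ε) * (p' * (v + L - R)) := by ring
    _ ≤ a * R + p' * (v + L - R) := by
      have : 0 ≤ p' * (v + L - R) := mul_nonneg hp' (by linarith)
      nlinarith
    _ ≤ a * R + p' * (v - a * (R - L)) := by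
      have : a * (R - L) ≤ R - L := mul_le_of_le_one_left (by linarith) ha1
      refine add_le_add_right (mul_le_mul_of_nonneg_left ?_ hp') _
      linarith
    _ = p' * (v + a * L) + (1 - p') * (a * R) := by ring
    _ ≤ p' * (v + L') + (1 - p') * R' := by
      have : 0 ≤ 1 - p' := by linarith
      gcongr

/-- One step when the probability is raised to `γ`, keeping the expected immediate reward. -/
theorem step_le_of_prob_rounded_up {γ a p v v' L R L' R' : ℝ} (ha : 0 ≤ a) (ha1 : a ≤ 1)
    (hγ : 0 ≤ γ) (hγ1 : γ ≤ 1) (hp : 0 ≤ p) (hv : 0 ≤ v) (hv' : γ * v' = p * v)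
    (hLR : L ≤ R) (hL' : 0 ≤ L') (hR : a * R ≤ R') :
    (1 - γ) * a * (p * (v + L) + (1 - p) * R) ≤ γ * (v' + L') + (1 - γ) * R' := by
  have hγ' : 0 ≤ 1 - γ := by linarith
  have hpv : 0 ≤ p * v := mul_nonneg hp hv
  have hb : (1 - γ) * a ≤ 1 := mul_le_one₀ (by linarith) ha ha1
  calc
    (1 - γ) * a * (p * (v + L) + (1 - p) * R)
        ≤ (1 - γ) * a * (p * (v + R) + (1 - p) * R) := by gcongr
    _ = (1 - γ) * a * (p * v) + (1 - γ) * (a * R) := by ring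
    _ ≤ p * v + (1 - γ) * R' :=
      add_le_add (mul_le_of_le_one_left hpv hb) (mul_le_mul_of_nonneg_left hR hγ')
    _ ≤ γ * (v' + L') + (1 - γ) * R' := by
      have := mul_nonneg hγ hL'
      linarith

theorem rewardAux_mixed_rounded_lower_bound {n k T : ℕ} {v p v' p' : Fin n → ℝ} {ε γ : ℝ}
    (hv : ∀ i, 0 ≤ v i) (hp : ∀ i, 0 ≤ p i ∧ p i ≤ 1) (hε : 0 < ε) (hγ : 0 < γ) (hγ1 : γ < 1)
    (hmix : MixedRounded n v p ε γ v' p') {H : Policy n} (hcan : Canonical v p k T H)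
    (f t κ : ℕ) (A : Finset (Fin n)) (ht : 1 ≤ t) (hft : f + t = T + 1) (hκ : κ ≤ k) :
    (1 - γ) ^ f / (1 + ε) * rewardAux v p H f t κ A ≤ rewardAux v' p' H f t κ A := by
  induction f generalizing t κ A with
  | zero => simp [rewardAux]
  | succ f ih =>
    rw [rewardAux, rewardAux]
    split_ifs with h
    · simp
    push Not at h
    obtain ⟨hκ0, hA⟩ := h
    have hc := hcan t κ A ht (by omega) (by omega) hκ hA
    simp only [reward, show T + 1 - (t + 1) = f by omega] at hc
    have hL := ih (t + 1) (κ - 1) (A.erase (H t κ A)) (by omega) (by omega) (by omega)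
    have hR := ih (t + 1) κ (A.erase (H t κ A)) (by omega) (by omega) hκ
    have hL0 := rewardAux_nonneg hv hp H f (t + 1) (κ - 1) (A.erase (H t κ A))
    have hR0 := rewardAux_nonneg hv hp H f (t + 1) κ (A.erase (H t κ A))
    generalize H t κ A = i at *
    have hγ' : 0 ≤ 1 - γ := by linarith
    have ha : 0 ≤ (1 - γ) ^ f / (1 + ε) := by positivity
    have hpow : (1 - γ) ^ f ≤ 1 := pow_le_one₀ hγ' (by linarith)
    have haε : (1 - γ) ^ f / (1 + ε) * (1 + ε) ≤ 1 := by
      rwa [div_mul_cancel₀ _ (by positivity)]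
    have ha1 : (1 - γ) ^ f / (1 + ε) ≤ 1 := by nlinarith
    rw [pow_succ', mul_div_assoc]
    rcases hmix.cases hε hγ i with ⟨h₁, h₂⟩ | ⟨h₁, h₂, h₃, h₄⟩
    · rw [h₁]
      exact step_le_of_prob_rounded_up ha ha1 hγ.le hγ1.le (hp i).1 (hv i) h₂ hc.1
        ((mul_nonneg ha hL0).trans hL) hR
    · rw [h₁]
      refine le_trans ?_ (step_le_of_prob_rounded_down ha haε hε.le h₂ h₃ (hp i).2 h₄ hc.1 hc.2
        hL hR)
      refine mul_le_mul_of_nonneg_right (mul_le_of_le_one_left ha (by linarith)) ?_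
      exact add_nonneg (mul_nonneg (hp i).1 (add_nonneg (hv i) hL0))
        (mul_nonneg (sub_nonneg.2 (hp i).2) hR0)


/-- If `H` is canonical for the original instance `I`, then
`R^{I↕}(H) ≥ (1 − 2ε)·R^I(H)`. -/
theorem canonical_reward_mixed_rounded_lower_bound
    (n k T : ℕ) (v p v' p' : Fin n → ℝ) (ε γ : ℝ)
    (hk : 1 ≤ k) (hT : 1 ≤ T)
    (hv : ∀ i, 0 ≤ v i) (hp : ∀ i, 0 ≤ p i ∧ p i ≤ 1)
    (hε0 : 0 < ε) (hε1 : ε < 1) (hγ : γ = ε / T) (hγ1 : γ < 1)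
    (hmix : MixedRounded n v p ε γ v' p')
    (H : Policy n) (hH : ValidPolicy n k T H)
    (hcan : Canonical v p k T H) :
    (1 - 2 * ε) * totalReward v p k T H ≤ totalReward v' p' k T H := by
  have hT0 : (0 : ℝ) < T := by exact_mod_cast hT
  have hγ0 : 0 < γ := hγ ▸ div_pos hε0 hT0
  have hTγ : (T : ℝ) * γ = ε := by rw [hγ]; field_simp
  have hmain := rewardAux_mixed_rounded_lower_bound hv hp hε0 hγ0 hγ1 hmix hcan T 1 k
    Finset.univ le_rfl rfl le_rfl
  have hbern : 1 - ε ≤ (1 - γ) ^ T := by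
    have := one_add_mul_le_pow (show (-2 : ℝ) ≤ -γ by linarith) T
    rw [← sub_eq_add_neg] at this
    linarith
  simp only [totalReward, reward, Nat.add_sub_cancel]
  refine le_trans (mul_le_mul_of_nonneg_right ?_ (rewardAux_nonneg hv hp H _ _ _ _)) hmain
  rw [le_div_iff₀ (by linarith)]
  nlinarith
end

section
/- Let H be a hiring policy that is canonical for the mixed-rounded instance I↕. Then R^I(H) ≥ R^{I↕}(H). -/
/-- Rounding one applicant does not increase the one-step expected reward, as long as the
continuation rewards `L` (position filled) and `R` (position still open) satisfy the canonical
inequalities for the rounded value. -/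
theorem MixedRounded.step_le {n : ℕ} {v p v' p' : Fin n → ℝ} {ε γ : ℝ}
    (hmix : MixedRounded n v p ε γ v' p') (hε : 0 < ε) (hγ : 0 < γ) (i : Fin n) {L R : ℝ}
    (hLR : L ≤ R) (hRv : R ≤ v' i + L) :
    p' i * (v' i + L) + (1 - p' i) * R ≤ p i * (v i + L) + (1 - p i) * R := by
  obtain ⟨hsmall, hlarge⟩ := hmix i
  rcases le_or_gt (p i) γ with h | h
  · obtain ⟨hp', hv'⟩ := hsmall h
    have hpv : p' i * v' i = p i * v i := by
      rw [hp', hv']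
      field_simp
    rw [← hp'] at h
    nlinarith [mul_nonneg (sub_nonneg.2 h) (sub_nonneg.2 hLR)]
  · have hex : ∃ m : ℕ, p i ≤ (1 + ε) ^ m * γ := by
      obtain ⟨m, hm⟩ := pow_unbounded_of_one_lt (p i / γ) (by linarith : 1 < 1 + ε)
      exact ⟨m, ((div_lt_iff₀ hγ).1 hm).le⟩
    classical
    have hm1 : 1 ≤ Nat.find hex := by
      rw [Nat.one_le_iff_ne_zero]
      intro h0
      have := Nat.find_spec hex
      rw [h0] at this
      linarith
    have hlt : (1 + ε) ^ (Nat.find hex - 1) * γ < p i :=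
      not_le.1 (Nat.find_min hex (by omega))
    obtain ⟨hp', hv'⟩ := hlarge _ hm1 hlt (Nat.find_spec hex)
    rw [← hp'] at hlt
    rw [hv'] at hRv ⊢
    nlinarith [mul_nonneg (sub_nonneg.2 hlt.le) (sub_nonneg.2 hRv)]

/-- Statewise comparison between the rounded and the original rewards of a policy that is
canonical for the mixed-rounded instance. -/
theorem MixedRounded.rewardAux_le {n k T : ℕ} {v p v' p' : Fin n → ℝ} {ε γ : ℝ}
    (hmix : MixedRounded n v p ε γ v' p') (hε : 0 < ε) (hγ : 0 < γ)
    (hp : ∀ i, 0 ≤ p i ∧ p i ≤ 1) {H : Policy n} (hcan : Canonical v' p' k T H)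
    (fuel t κ : ℕ) (A : Finset (Fin n)) (ht : 1 ≤ t) (hfuel : t + fuel = T + 1) (hκ : κ ≤ k) :
    rewardAux v' p' H fuel t κ A ≤ rewardAux v p H fuel t κ A := by
  induction fuel generalizing t κ A with
  | zero => simp [rewardAux]
  | succ fuel ih =>
    by_cases h : κ = 0 ∨ A = ∅
    · simp [rewardAux, h]
    · have hA : A.Nonempty := Finset.nonempty_iff_ne_empty.2 fun h' => h (Or.inr h')
      have hκ1 : 1 ≤ κ := Nat.one_le_iff_ne_zero.2 fun h' => h (Or.inl h')
      have hc := hcan t κ A ht (by omega) hκ1 hκ hA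
      simp only [reward, show T + 1 - (t + 1) = fuel by omega] at hc
      simp only [rewardAux, h, if_false]
      refine (hmix.step_le hε hγ (H t κ A) hc.1 hc.2).trans ?_
      have hL := ih (t + 1) (κ - 1) (A.erase (H t κ A)) (by omega) (by omega) (by omega)
      have hR := ih (t + 1) κ (A.erase (H t κ A)) (by omega) (by omega) hκ
      have hq : 0 ≤ 1 - p (H t κ A) := sub_nonneg.2 (hp _).2
      have hp0 := (hp (H t κ A)).1
      gcongr

/-- If `H` is canonical for the mixed-rounded instance `I↕`, then
`R^I(H) ≥ R^{I↕}(H)`. -/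
theorem canonical_mixed_rounded_reward_dominated
    (n k T : ℕ) (v p v' p' : Fin n → ℝ) (ε γ : ℝ)
    (hk : 1 ≤ k) (hT : 1 ≤ T)
    (hv : ∀ i, 0 ≤ v i) (hp : ∀ i, 0 ≤ p i ∧ p i ≤ 1)
    (hε0 : 0 < ε) (hε1 : ε < 1) (hγ : γ = ε / T) (hγ1 : γ < 1)
    (hmix : MixedRounded n v p ε γ v' p')
    (H : Policy n) (hH : ValidPolicy n k T H)
    (hcan : Canonical v' p' k T H) :
    totalReward v' p' k T H ≤ totalReward v p k T H := by
  have hγ0 : 0 < γ := by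
    rw [hγ]
    exact div_pos hε0 (by exact_mod_cast hT)
  exact hmix.rewardAux_le hε0 hγ0 hp hcan (T + 1 - 1) 1 k Finset.univ le_rfl (by omega) le_rfl
end

section
/- For every block-responsive policy H^B there exists a canonical block-responsive policy H̃^B whose total expected reward satisfies R(H̃^B) ≥ R(H^B). -/
/-- A block-responsive policy: assigns to every state an ordered list (block) of
applicants. -/
def BlockPolicy (n : ℕ) : Type := ℕ → ℕ → Finset (Fin n) → List (Fin n)

/-- Validity of a block-responsive policy: at every state `(t, κ, A)` with
`1 ≤ t ≤ T`, `1 ≤ κ ≤ k`, `A ≠ ∅`, the chosen block is a nonempty list of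
distinct available applicants whose length `m` satisfies `t + m ≤ T + 1`. -/
def ValidBlockPolicy (n k T : ℕ) (HB : BlockPolicy n) : Prop :=
  ∀ t κ : ℕ, ∀ A : Finset (Fin n), 1 ≤ t → t ≤ T → 1 ≤ κ → κ ≤ k → A.Nonempty →
    HB t κ A ≠ [] ∧ (HB t κ A).Nodup ∧ (∀ i ∈ HB t κ A, i ∈ A) ∧
      t + (HB t κ A).length ≤ T + 1

/-- Sequentially extending offers within a block: `left` is collected when everyone
rejects, `v i + right` when applicant `i` is the first to accept. -/
noncomputable def seqReward {n : ℕ} (v p : Fin n → ℝ) :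
    List (Fin n) → ℝ → ℝ → ℝ
  | [], left, _ => left
  | i :: rest, left, right =>
      p i * (v i + right) + (1 - p i) * seqReward v p rest left right

/-- Expected reward of a block-responsive policy, with explicit fuel `T + 1 - t`. -/
noncomputable def blockRewardAux {n : ℕ} (v p : Fin n → ℝ) (HB : BlockPolicy n)
    (fuel t κ : ℕ) (A : Finset (Fin n)) : ℝ :=
  if h : fuel = 0 ∨ κ = 0 ∨ A = ∅ then 0
  else
    seqReward v p (HB t κ A)
      (blockRewardAux v p HB (fuel - max (HB t κ A).length 1)
        (t + (HB t κ A).length) κ (A \ (HB t κ A).toFinset))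
      (blockRewardAux v p HB (fuel - max (HB t κ A).length 1)
        (t + (HB t κ A).length) (κ - 1) (A \ (HB t κ A).toFinset))
termination_by fuel
decreasing_by
  all_goals
    push_neg at h
    have h2 := Nat.le_max_right (HB t κ A).length 1
    omega

/-- Expected reward `R_{H^B}(t, κ, A)` of a block-responsive policy from a state;
it vanishes as soon as `t = T + 1`, `κ = 0`, or `A = ∅`. -/
noncomputable def blockReward {n : ℕ} (v p : Fin n → ℝ) (T : ℕ) (HB : BlockPolicy n)
    (t κ : ℕ) (A : Finset (Fin n)) : ℝ :=
  blockRewardAux v p HB (T + 1 - t) t κ A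

/-- Total expected reward `R(H^B) = R_{H^B}(1, k, [n])`. -/
noncomputable def blockTotalReward {n : ℕ} (v p : Fin n → ℝ) (k T : ℕ)
    (HB : BlockPolicy n) : ℝ :=
  blockReward v p T HB 1 k Finset.univ

/-- Tail reward `R_{H^B}(t, κ, A; r)`: offers start from the `r`-th applicant of the
block chosen at `(t, κ, A)`. -/
noncomputable def blockTail {n : ℕ} (v p : Fin n → ℝ) (T : ℕ) (HB : BlockPolicy n)
    (t κ : ℕ) (A : Finset (Fin n)) (r : ℕ) : ℝ :=
  seqReward v p ((HB t κ A).drop (r - 1))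
    (blockReward v p T HB (t + (HB t κ A).length) κ (A \ (HB t κ A).toFinset))
    (blockReward v p T HB (t + (HB t κ A).length) (κ - 1) (A \ (HB t κ A).toFinset))

/-- A block-responsive policy is canonical: the L≥R-block and V+R≥L-block
properties hold at every state and every rank `r = q + 1` (with `q < m`). -/
def CanonicalBlock {n : ℕ} (v p : Fin n → ℝ) (k T : ℕ) (HB : BlockPolicy n) : Prop :=
  ∀ t κ : ℕ, ∀ A : Finset (Fin n), 1 ≤ t → t ≤ T → 1 ≤ κ → κ ≤ k → A.Nonempty →
    ∀ q : ℕ, ∀ hq : q < (HB t κ A).length,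
      blockReward v p T HB (t + (HB t κ A).length) (κ - 1)
            (A \ (HB t κ A).toFinset) ≤
          blockTail v p T HB t κ A (q + 2) ∧
        blockTail v p T HB t κ A (q + 2) ≤
          v ((HB t κ A).get ⟨q, hq⟩) +
            blockReward v p T HB (t + (HB t κ A).length) (κ - 1)
              (A \ (HB t κ A).toFinset)

section AdaptiveValue

variable {n : ℕ} (v p : Fin n → ℝ)

/-- Expected reward of offering to an applicant with acceptance probability `a` and value `x`,
when the continuation is worth `r` after an acceptance and `l` after a rejection. -/
def offerReward (a x r l : ℝ) : ℝ := a * (x + r) + (1 - a) * l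

/-- Optimal expected reward of fully adaptive offers with `s` offers left, `κ` open positions
and available applicants `A`. -/
noncomputable def adaptiveValue : ℕ → ℕ → Finset (Fin n) → ℝ
  | 0, _, _ => 0
  | _ + 1, 0, _ => 0
  | s + 1, κ + 1, A =>
    if h : A.Nonempty then
      A.sup' h fun i => offerReward (p i) (v i) (adaptiveValue s κ (A.erase i))
        (adaptiveValue s (κ + 1) (A.erase i))
    else 0

/-- Optimal expected reward when the next offer goes to `i`, with `s` offers and `κ` positions
left after it is accepted. -/
noncomputable def adaptiveOffer (s κ : ℕ) (A : Finset (Fin n)) (i : Fin n) : ℝ :=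
  offerReward (p i) (v i) (adaptiveValue v p s κ (A.erase i))
    (adaptiveValue v p s (κ + 1) (A.erase i))

variable {v p}

theorem offerReward_mono {a x r l r' l' : ℝ} (h0 : 0 ≤ a) (h1 : a ≤ 1) (hr : r ≤ r')
    (hl : l ≤ l') : offerReward a x r l ≤ offerReward a x r' l' := by
  have : 0 ≤ 1 - a := by linarith
  unfold offerReward
  gcongr

theorem adaptiveValue_zero_left (κ : ℕ) (A : Finset (Fin n)) : adaptiveValue v p 0 κ A = 0 := by
  simp [adaptiveValue]

theorem adaptiveValue_zero_right (s : ℕ) (A : Finset (Fin n)) : adaptiveValue v p s 0 A = 0 := by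
  cases s <;> simp [adaptiveValue]

theorem adaptiveValue_empty (s κ : ℕ) : adaptiveValue v p s κ (∅ : Finset (Fin n)) = 0 := by
  cases s <;> cases κ <;> simp [adaptiveValue]

theorem adaptiveOffer_le_adaptiveValue {A : Finset (Fin n)} {i : Fin n} (hi : i ∈ A) (s κ : ℕ) :
    adaptiveOffer v p s κ A i ≤ adaptiveValue v p (s + 1) (κ + 1) A := by
  rw [adaptiveValue, dif_pos ⟨i, hi⟩]
  exact Finset.le_sup' (adaptiveOffer v p s κ A) hi

theorem exists_adaptiveValue_eq {A : Finset (Fin n)} (hA : A.Nonempty) (s κ : ℕ) :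
    ∃ i ∈ A, adaptiveValue v p (s + 1) (κ + 1) A = adaptiveOffer v p s κ A i := by
  rw [adaptiveValue, dif_pos hA]
  exact A.exists_mem_eq_sup' hA (adaptiveOffer v p s κ A)

theorem adaptiveValue_nonneg (hv : ∀ i, 0 ≤ v i) (hp : ∀ i, 0 ≤ p i ∧ p i ≤ 1) :
    ∀ (s κ : ℕ) (A : Finset (Fin n)), 0 ≤ adaptiveValue v p s κ A
  | 0, κ, A => (adaptiveValue_zero_left κ A).ge
  | s + 1, 0, A => (adaptiveValue_zero_right (s + 1) A).ge
  | s + 1, κ + 1, A => by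
    rcases A.eq_empty_or_nonempty with rfl | hA
    · exact (adaptiveValue_empty _ _).ge
    obtain ⟨i, -, hi⟩ := exists_adaptiveValue_eq (v := v) (p := p) hA s κ
    have h1 := adaptiveValue_nonneg hv hp s κ (A.erase i)
    have h2 := adaptiveValue_nonneg hv hp s (κ + 1) (A.erase i)
    have h3 := sub_nonneg.2 (hp i).2
    have h4 := (hp i).1
    have h5 := hv i
    rw [hi, adaptiveOffer, offerReward]
    positivity

/-- The optimal adaptive reward is monotone in the horizon, the number of positions and the set
of applicants: additional resources can be kept until the end. -/
theorem adaptiveValue_mono (hv : ∀ i, 0 ≤ v i) (hp : ∀ i, 0 ≤ p i ∧ p i ≤ 1) {s s' κ κ' : ℕ}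
    {A A' : Finset (Fin n)} (hs : s ≤ s') (hκ : κ ≤ κ') (hA : A ⊆ A') :
    adaptiveValue v p s κ A ≤ adaptiveValue v p s' κ' A' := by
  induction s generalizing s' κ κ' A A' with
  | zero =>
    rw [adaptiveValue_zero_left]
    exact adaptiveValue_nonneg hv hp _ _ _
  | succ s ih =>
    obtain _ | κ := κ
    · rw [adaptiveValue_zero_right]
      exact adaptiveValue_nonneg hv hp _ _ _
    rcases A.eq_empty_or_nonempty with rfl | hne
    · rw [adaptiveValue_empty]
      exact adaptiveValue_nonneg hv hp _ _ _
    obtain ⟨s', rfl⟩ : ∃ u, s' = u + 1 := ⟨s' - 1, by omega⟩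
    obtain ⟨κ', rfl⟩ : ∃ u, κ' = u + 1 := ⟨κ' - 1, by omega⟩
    obtain ⟨i, hi, h⟩ := exists_adaptiveValue_eq (v := v) (p := p) hne s κ
    rw [h]
    refine le_trans ?_ (adaptiveOffer_le_adaptiveValue (hA hi) s' κ')
    exact offerReward_mono (hp i).1 (hp i).2
      (ih (by omega) (by omega) (Finset.erase_subset_erase i hA))
      (ih (by omega) (by omega) (Finset.erase_subset_erase i hA))

theorem adaptiveValue_eq_zero_of_forall_eq_zero {s κ : ℕ} {A : Finset (Fin n)}
    (h : ∀ i ∈ A, p i = 0) : adaptiveValue v p s κ A = 0 := by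
  induction s generalizing κ A with
  | zero => exact adaptiveValue_zero_left κ A
  | succ s ih =>
    obtain _ | κ := κ
    · exact adaptiveValue_zero_right _ _
    rcases A.eq_empty_or_nonempty with rfl | hne
    · exact adaptiveValue_empty _ _
    obtain ⟨i, hi, h'⟩ := exists_adaptiveValue_eq (v := v) (p := p) hne s κ
    rw [h', adaptiveOffer, ih fun j hj => h j (Finset.mem_of_mem_erase hj),
      ih fun j hj => h j (Finset.mem_of_mem_erase hj), offerReward, h i hi]
    ring

/-- Unless nobody ever accepts, some optimal next offer has a positive acceptance probability. -/
theorem exists_pos_adaptiveValue_le (hv : ∀ i, 0 ≤ v i) (hp : ∀ i, 0 ≤ p i ∧ p i ≤ 1) {s κ : ℕ}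
    {A : Finset (Fin n)} (h : ∃ j ∈ A, 0 < p j) :
    ∃ i ∈ A, 0 < p i ∧ adaptiveValue v p (s + 1) (κ + 1) A ≤ adaptiveOffer v p s κ A i := by
  induction s generalizing A with
  | zero =>
    obtain ⟨j, hj, hpj⟩ := h
    obtain ⟨i, hi, h'⟩ := exists_adaptiveValue_eq (v := v) (p := p) ⟨j, hj⟩ 0 κ
    rcases (hp i).1.eq_or_lt with h0 | h0
    · refine ⟨j, hj, hpj, ?_⟩
      rw [h']
      simp only [adaptiveOffer, offerReward, adaptiveValue_zero_left, ← h0]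
      have := mul_nonneg hpj.le (hv j)
      linarith
    · exact ⟨i, hi, h0, h'.le⟩
  | succ s ih =>
    obtain ⟨j, hj, hpj⟩ := h
    obtain ⟨i, hi, h'⟩ := exists_adaptiveValue_eq (v := v) (p := p) ⟨j, hj⟩ (s + 1) κ
    rcases (hp i).1.eq_or_lt with h0 | h0
    · have hji : j ≠ i := by
        rintro rfl
        exact hpj.ne h0
      obtain ⟨l, hl, hpl, hle⟩ := ih ⟨j, Finset.mem_erase.2 ⟨hji, hj⟩, hpj⟩
      refine ⟨l, Finset.mem_of_mem_erase hl, hpl, ?_⟩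
      calc adaptiveValue v p (s + 1 + 1) (κ + 1) A
          = adaptiveValue v p (s + 1) (κ + 1) (A.erase i) := by
            rw [h', adaptiveOffer, offerReward, ← h0]
            ring
        _ ≤ _ := hle
        _ ≤ _ := offerReward_mono (hp l).1 (hp l).2
            (adaptiveValue_mono hv hp s.le_succ le_rfl
              (Finset.erase_subset_erase l (Finset.erase_subset i A)))
            (adaptiveValue_mono hv hp s.le_succ le_rfl
              (Finset.erase_subset_erase l (Finset.erase_subset i A)))
    · exact ⟨i, hi, h0, h'.le⟩

/-- There is an optimal next offer whose acceptance is at least as good as its rejection. -/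
theorem exists_canonical_adaptiveOffer (hv : ∀ i, 0 ≤ v i) (hp : ∀ i, 0 ≤ p i ∧ p i ≤ 1)
    {A : Finset (Fin n)} (hA : A.Nonempty) (s κ : ℕ) :
    ∃ i ∈ A, adaptiveValue v p (s + 1) (κ + 1) A = adaptiveOffer v p s κ A i ∧
      adaptiveValue v p s (κ + 1) (A.erase i) ≤ v i + adaptiveValue v p s κ (A.erase i) := by
  by_cases h : ∃ j ∈ A, 0 < p j
  · obtain ⟨i, hi, hpi, hle⟩ := exists_pos_adaptiveValue_le hv hp (s := s) (κ := κ) h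
    refine ⟨i, hi, le_antisymm hle (adaptiveOffer_le_adaptiveValue hi s κ), ?_⟩
    have hmono : adaptiveValue v p s (κ + 1) (A.erase i) ≤ adaptiveOffer v p s κ A i :=
      (adaptiveValue_mono hv hp s.le_succ le_rfl (A.erase_subset i)).trans hle
    rw [adaptiveOffer, offerReward] at hmono
    refine le_of_mul_le_mul_left ?_ hpi
    linarith
  · have h0 : ∀ j ∈ A, p j = 0 := fun j hj =>
      le_antisymm (not_lt.1 fun hlt => h ⟨j, hj, hlt⟩) (hp j).1
    obtain ⟨i, hi, h'⟩ := exists_adaptiveValue_eq (v := v) (p := p) hA s κ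
    refine ⟨i, hi, h', ?_⟩
    rw [adaptiveValue_eq_zero_of_forall_eq_zero fun j hj => h0 j (Finset.mem_of_mem_erase hj)]
    exact add_nonneg (hv i) (adaptiveValue_nonneg hv hp _ _ _)

theorem seqReward_le_adaptiveValue (hv : ∀ i, 0 ≤ v i) (hp : ∀ i, 0 ≤ p i ∧ p i ≤ 1)
    {s κ : ℕ} {l r : ℝ} {B : List (Fin n)} {A : Finset (Fin n)} (hB : B.Nodup)
    (hBA : ∀ i ∈ B, i ∈ A) (hl : l ≤ adaptiveValue v p s (κ + 1) (A \ B.toFinset))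
    (hr : r ≤ adaptiveValue v p s κ (A \ B.toFinset)) :
    seqReward v p B l r ≤ adaptiveValue v p (s + B.length) (κ + 1) A := by
  induction B generalizing A with
  | nil => simpa [seqReward] using hl
  | cons i B ih =>
    rw [List.nodup_cons] at hB
    have hsdiff : A \ (i :: B).toFinset = A.erase i \ B.toFinset := by
      ext j
      simp only [Finset.mem_sdiff, List.mem_toFinset, List.mem_cons, Finset.mem_erase]
      tauto
    rw [hsdiff] at hl hr
    refine le_trans ?_ (adaptiveOffer_le_adaptiveValue (hBA i (by simp)) (s + B.length) κ)
    refine offerReward_mono (hp i).1 (hp i).2 ?_ (ih hB.2 (fun j hj => ?_) hl hr)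
    · exact hr.trans (adaptiveValue_mono hv hp (by omega) le_rfl Finset.sdiff_subset)
    · refine Finset.mem_erase.2 ⟨?_, hBA j (by simp [hj])⟩
      rintro rfl
      exact hB.1 hj

end AdaptiveValue

section BlockReward

variable {n k T : ℕ} {v p : Fin n → ℝ}

theorem blockReward_eq_zero {HB : BlockPolicy n} {t κ : ℕ} {A : Finset (Fin n)}
    (h : T + 1 - t = 0 ∨ κ = 0 ∨ A = ∅) : blockReward v p T HB t κ A = 0 := by
  rw [blockReward, blockRewardAux, dif_pos h]

theorem blockReward_eq_seqReward {HB : BlockPolicy n} {t κ : ℕ} {A : Finset (Fin n)}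
    (ht : t ≤ T) (hκ : κ ≠ 0) (hA : A.Nonempty) (hB : HB t κ A ≠ []) :
    blockReward v p T HB t κ A = seqReward v p (HB t κ A)
      (blockReward v p T HB (t + (HB t κ A).length) κ (A \ (HB t κ A).toFinset))
      (blockReward v p T HB (t + (HB t κ A).length) (κ - 1) (A \ (HB t κ A).toFinset)) := by
  have hlen : max (HB t κ A).length 1 = (HB t κ A).length :=
    max_eq_left (List.length_pos_iff.2 hB)
  rw [blockReward, blockRewardAux, dif_neg (by simp [hκ, hA.ne_empty]; omega), hlen,
    Nat.sub_sub]
  rfl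

theorem blockReward_le_adaptiveValue (hv : ∀ i, 0 ≤ v i) (hp : ∀ i, 0 ≤ p i ∧ p i ≤ 1)
    {HB : BlockPolicy n} (hHB : ValidBlockPolicy n k T HB) {t κ : ℕ} (A : Finset (Fin n))
    (ht : 1 ≤ t) (hκ : κ ≤ k) :
    blockReward v p T HB t κ A ≤ adaptiveValue v p (T + 1 - t) κ A := by
  induction hs : T + 1 - t using Nat.strong_induction_on generalizing t κ A with
  | _ s ih =>
    subst hs
    by_cases h : T + 1 - t = 0 ∨ κ = 0 ∨ A = ∅
    · rw [blockReward_eq_zero h]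
      exact adaptiveValue_nonneg hv hp _ _ _
    push Not at h
    obtain ⟨hne, hnodup, hmem, hlen⟩ :=
      hHB t κ A ht (by omega) (by omega) hκ h.2.2
    have hpos := List.length_pos_iff.2 hne
    rw [blockReward_eq_seqReward (by omega) h.2.1 h.2.2 hne]
    obtain ⟨κ, rfl⟩ : ∃ u, κ = u + 1 := ⟨κ - 1, by omega⟩
    rw [show T + 1 - t = T + 1 - (t + (HB t (κ + 1) A).length) + (HB t (κ + 1) A).length by omega]
    exact seqReward_le_adaptiveValue hv hp hnodup hmem
      (ih _ (by omega) _ (by omega) hκ rfl)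
      (ih _ (by omega) _ (by omega) (by omega) rfl)

/-- A policy of singleton blocks consisting of optimal adaptive offers is itself optimal. -/
theorem blockReward_eq_adaptiveValue {HB : BlockPolicy n}
    (hHB : ∀ (t κ : ℕ) (A : Finset (Fin n)), t ≤ T → A.Nonempty → ∃ i ∈ A,
      HB t (κ + 1) A = [i] ∧
        adaptiveValue v p (T - t + 1) (κ + 1) A = adaptiveOffer v p (T - t) κ A i)
    (t κ : ℕ) (A : Finset (Fin n)) :
    blockReward v p T HB t κ A = adaptiveValue v p (T + 1 - t) κ A := by
  induction hs : T + 1 - t generalizing t κ A with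
  | zero => rw [blockReward_eq_zero (Or.inl hs), adaptiveValue_zero_left]
  | succ s ih =>
    obtain _ | κ := κ
    · rw [blockReward_eq_zero (by simp), adaptiveValue_zero_right]
    rcases A.eq_empty_or_nonempty with rfl | hA
    · rw [blockReward_eq_zero (by simp), adaptiveValue_empty]
    obtain ⟨i, -, hi, hval⟩ := hHB t κ A (by omega) hA
    obtain rfl : s = T - t := by omega
    rw [blockReward_eq_seqReward (by omega) (by omega) hA (by simp [hi]), hval, hi]
    simp only [List.length_singleton, List.toFinset_cons, List.toFinset_nil, insert_empty_eq,
      Finset.sdiff_singleton_eq_erase, Nat.add_sub_cancel, seqReward]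
    rw [ih _ _ _ (by omega), ih _ _ _ (by omega)]
    rfl

end BlockReward

/-- For every block-responsive policy `H^B` there exists a
canonical block-responsive policy `H̃^B` with `R(H̃^B) ≥ R(H^B)`. -/
theorem exists_canonical_block_responsive_dominating
    (n k T : ℕ) (v p : Fin n → ℝ)
    (hk : 1 ≤ k) (hT : 1 ≤ T)
    (hv : ∀ i, 0 ≤ v i) (hp : ∀ i, 0 ≤ p i ∧ p i ≤ 1)
    (HB : BlockPolicy n) (hHB : ValidBlockPolicy n k T HB) :
    ∃ HBtilde : BlockPolicy n, ValidBlockPolicy n k T HBtilde ∧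
      CanonicalBlock v p k T HBtilde ∧
      blockTotalReward v p k T HB ≤ blockTotalReward v p k T HBtilde := by
  have hchoice (t κ : ℕ) (A : Finset (Fin n)) : ∃ B : List (Fin n), A.Nonempty →
      ∃ i ∈ A, B = [i] ∧
        adaptiveValue v p (T - t + 1) (κ - 1 + 1) A = adaptiveOffer v p (T - t) (κ - 1) A i ∧
        adaptiveValue v p (T - t) (κ - 1 + 1) (A.erase i) ≤
          v i + adaptiveValue v p (T - t) (κ - 1) (A.erase i) := by
    by_cases hA : A.Nonempty
    · obtain ⟨i, hi, h⟩ := exists_canonical_adaptiveOffer hv hp hA (T - t) (κ - 1)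
      exact ⟨[i], fun _ => ⟨i, hi, rfl, h⟩⟩
    · exact ⟨[], fun h => absurd h hA⟩
  choose H hH using hchoice
  have hval := blockReward_eq_adaptiveValue (v := v) (p := p) (T := T) (HB := H)
    fun t κ A _ hA =>
      let ⟨i, hi, hB, h, _⟩ := hH t (κ + 1) A hA
      ⟨i, hi, hB, h⟩
  refine ⟨H, fun t κ A _ ht _ _ hA => ?_, fun t κ A _ ht hκ _ hA q hq => ?_, ?_⟩
  · obtain ⟨i, hi, hB, -⟩ := hH t κ A hA
    simp [hB, hi, ht]
  · obtain ⟨i, -, hB, -, hle⟩ := hH t κ A hA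
    obtain ⟨κ, rfl⟩ : ∃ u, κ = u + 1 := ⟨κ - 1, by omega⟩
    obtain rfl : q = 0 := by simpa [hB] using hq
    have hmono := adaptiveValue_mono (v := v) (p := p) hv hp (le_refl (T - t)) κ.le_succ
      (Finset.Subset.refl (A.erase i))
    have hget : (H t (κ + 1) A)[0] = i := by simp [hB]
    simp only [blockTail, hval, List.get_eq_getElem, hget]
    simpa [hB, seqReward, Finset.sdiff_singleton_eq_erase] using And.intro hmono hle
  · simp only [blockTotalReward, hval]
    exact blockReward_le_adaptiveValue hv hp hHB _ le_rfl le_rfl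
end
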